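/- Refined Sobolev inequality: for every f ∈ Ḣ¹(ℝ^N) (N ≥ 3), ‖f‖_{L^{2N/(N-2)}} ≤ C ‖∇f‖_{L²}^{1−2/N} ‖∇f‖_{Ḃ⁰_{2,∞}}^{2/N}, where ‖g‖_{Ḃ⁰_{2,∞}} = sup_{k∈ℤ} ‖P_k g‖_{L²} with P_k the Littlewood–Paley projection to frequencies |ξ| ∼ 2^k. -/

import Mathlib

open MeasureTheory Real FourierTransform
open scoped SchwartzMap ENNReal LineDeriv

/-- If the distribution function of `F` is controlled at each level `t` by `t⁻²` times the mass of
`G` on the superlevel set `{t ≤ L}`, the layer cake formula bounds the `p`-th moment of `F`. -/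
theorem lintegral_rpow_le_of_meas_lt_le {α β : Type*} [MeasurableSpace α] [MeasurableSpace β]
    {μ : Measure α} {ν : Measure β} [SFinite ν] {F : α → ℝ} (hF : Measurable F)
    (hF0 : ∀ x, 0 ≤ F x) {G : β → ℝ≥0∞} (hG : Measurable G) {L : β → ℝ} (hL : Measurable L)
    (hL0 : ∀ y, 0 ≤ L y) {p c : ℝ} (hp : 2 < p) (hc : 0 ≤ c)
    (h : ∀ t, 0 < t → μ {x | t < F x} ≤
      ENNReal.ofReal (c * t ^ (-2 : ℝ)) * ∫⁻ y in {y | t ≤ L y}, G y ∂ν) :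
    ∫⁻ x, ENNReal.ofReal (F x ^ p) ∂μ ≤
      ENNReal.ofReal (p * c / (p - 2)) * ∫⁻ y, ENNReal.ofReal (L y ^ (p - 2)) * G y ∂ν := by
  have hset : MeasurableSet {z : ℝ × β | z.1 ≤ L z.2} :=
    measurableSet_le measurable_fst (hL.comp measurable_snd)
  rw [lintegral_rpow_eq_lintegral_meas_lt_mul μ (Filter.Eventually.of_forall hF0)
    hF.aemeasurable (by linarith)]
  have inner : ∀ y, ∫⁻ t in Set.Ioi (0 : ℝ), {z : ℝ × β | z.1 ≤ L z.2}.indicator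
      (fun z => ENNReal.ofReal (c * z.1 ^ (p - 3)) * G z.2) (t, y)
      = ENNReal.ofReal (c / (p - 2)) * (ENNReal.ofReal (L y ^ (p - 2)) * G y) := by
    intro y
    have e : ∀ t, {z : ℝ × β | z.1 ≤ L z.2}.indicator
        (fun z => ENNReal.ofReal (c * z.1 ^ (p - 3)) * G z.2) (t, y)
        = (Set.Iic (L y)).indicator (fun t => ENNReal.ofReal (c * t ^ (p - 3)) * G y) t := by
      intro t
      simp [Set.indicator]
    simp_rw [e]
    rw [lintegral_indicator measurableSet_Iic, Measure.restrict_restrict measurableSet_Iic,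
      Set.inter_comm, Set.Ioi_inter_Iic, lintegral_mul_const _ (by fun_prop),
      ← ofReal_integral_eq_lintegral_ofReal]
    · rw [← intervalIntegral.integral_of_le (hL0 y), intervalIntegral.integral_const_mul,
        integral_rpow (Or.inl (by linarith)), Real.zero_rpow (by linarith), ← mul_assoc,
        ← ENNReal.ofReal_mul (by apply div_nonneg hc; linarith)]
      congr 2
      rw [show p - 3 + 1 = p - 2 by ring]
      ring
    · refine (intervalIntegrable_iff_integrableOn_Ioc_of_le (hL0 y)).1 ?_
      exact (intervalIntegral.intervalIntegrable_rpow' (by linarith)).const_mul c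
    · filter_upwards [ae_restrict_mem measurableSet_Ioc] with t ht
      have := ht.1
      simp only [Pi.zero_apply]
      positivity
  calc _ ≤ ENNReal.ofReal p * ∫⁻ t in Set.Ioi (0 : ℝ), ∫⁻ y,
        {z : ℝ × β | z.1 ≤ L z.2}.indicator
          (fun z => ENNReal.ofReal (c * z.1 ^ (p - 3)) * G z.2) (t, y) ∂ν := by
        gcongr ENNReal.ofReal p * ?_
        refine setLIntegral_mono' measurableSet_Ioi fun t ht => ?_
        have ht' : 0 < t := ht
        calc _ ≤ ENNReal.ofReal (c * t ^ (-2 : ℝ)) * (∫⁻ y in {y | t ≤ L y}, G y ∂ν)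
              * ENNReal.ofReal (t ^ (p - 1)) := by gcongr; exact h t ht
          _ = ENNReal.ofReal (c * t ^ (p - 3)) * ∫⁻ y in {y | t ≤ L y}, G y ∂ν := by
            rw [mul_right_comm, ← ENNReal.ofReal_mul (by positivity), mul_assoc c,
              ← Real.rpow_add ht']
            ring_nf
          _ = _ := by
            rw [← lintegral_const_mul _ hG, ← lintegral_indicator (measurableSet_le
              measurable_const hL)]
            rfl
    _ = _ := by
        rw [lintegral_lintegral_swap]
        · simp_rw [inner]
          rw [lintegral_const_mul _ (by fun_prop), ← mul_assoc,
            ← ENNReal.ofReal_mul (by linarith), mul_div_assoc]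
        · exact (Measurable.indicator (by fun_prop) hset).aemeasurable

section Fourier

variable {V : Type*} [NormedAddCommGroup V] [InnerProductSpace ℝ V] [FiniteDimensional ℝ V]
  [MeasurableSpace V] [BorelSpace V]

theorem SchwartzMap.lintegral_enorm_sq_fourier (f : 𝓢(V, ℂ)) :
    ∫⁻ x, ‖𝓕 f x‖ₑ ^ 2 = ∫⁻ x, ‖f x‖ₑ ^ 2 := by
  have key (g : 𝓢(V, ℂ)) : ∫⁻ x, ‖g x‖ₑ ^ 2 = ENNReal.ofReal (∫ x, ‖g x‖ ^ 2) := by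
    rw [ofReal_integral_eq_lintegral_ofReal]
    · simp_rw [ENNReal.ofReal_pow (norm_nonneg _), ofReal_norm]
    · exact (g.memLp 2).integrable_norm_pow (by simp)
    · exact Filter.Eventually.of_forall fun x => by positivity
  rw [key, key, SchwartzMap.integral_norm_sq_fourier]

/-- Smooth splitting of a Schwartz function into low and high frequencies. -/
theorem SchwartzMap.exists_add_low_high (f : 𝓢(V, ℂ)) {r : ℝ} (hr : 0 < r) :
    ∃ u v : 𝓢(V, ℂ), f = u + v ∧
      (∀ x, ‖u x‖ₑ ≤ ∫⁻ ξ in Metric.ball 0 (2 * r), ‖𝓕 f ξ‖ₑ) ∧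
      ∫⁻ x, ‖v x‖ₑ ^ 2 ≤ ∫⁻ ξ in {ξ | r ≤ ‖ξ‖}, ‖𝓕 f ξ‖ₑ ^ 2 := by
  let χ : ContDiffBump (0 : V) := ⟨r, 2 * r, hr, by linarith⟩
  have hcs : HasCompactSupport (fun ξ => (χ ξ : ℂ) * 𝓕 f ξ) :=
    (χ.hasCompactSupport.comp_left (g := fun t : ℝ => (t : ℂ)) (by simp)).mul_right
  have hsm : ContDiff ℝ (⊤ : ℕ∞) (fun ξ => (χ ξ : ℂ) * 𝓕 f ξ) :=
    (Complex.ofRealCLM.contDiff.comp χ.contDiff).mul ((𝓕 f).smooth _)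
  let g : 𝓢(V, ℂ) := hcs.toSchwartzMap hsm
  have hg (ξ) : g ξ = χ ξ * 𝓕 f ξ := rfl
  refine ⟨𝓕⁻ g, 𝓕⁻ (𝓕 f - g), ?_, ?_, ?_⟩
  · rw [← FourierTransform.fourierInv_add]
    simp
  · intro x
    rw [SchwartzMap.fourierInv_coe, Real.fourierInv_eq]
    refine (enorm_integral_le_lintegral_enorm _).trans ?_
    rw [← lintegral_indicator Metric.isOpen_ball.measurableSet]
    refine lintegral_mono fun ξ => ?_
    have : ‖𝐞 (inner ℝ ξ x) • g ξ‖ₑ = ‖g ξ‖ₑ := by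
      rw [← ofReal_norm, ← ofReal_norm, Circle.norm_smul]
    rw [this, hg]
    by_cases h : ξ ∈ Metric.ball 0 (2 * r)
    · rw [Set.indicator_of_mem h, enorm_mul]
      refine mul_le_of_le_one_left' ?_
      rw [← ofReal_norm, Complex.norm_real, Real.norm_of_nonneg χ.nonneg]
      exact ENNReal.ofReal_le_one.2 χ.le_one
    · rw [χ.zero_of_le_dist (by simpa using h)]
      simp
  · rw [← SchwartzMap.lintegral_enorm_sq_fourier, FourierTransform.fourier_fourierInv_eq,
      ← lintegral_indicator (measurableSet_le measurable_const measurable_norm)]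
    refine lintegral_mono fun ξ => ?_
    have e : (𝓕 f - g) ξ = ((1 - χ ξ : ℝ) : ℂ) * 𝓕 f ξ := by
      rw [sub_apply, hg]
      push_cast
      ring
    rw [e]
    by_cases h : r ≤ ‖ξ‖
    · rw [Set.indicator_of_mem (by exact h), enorm_mul]
      gcongr
      refine mul_le_of_le_one_left' ?_
      rw [← ofReal_norm, Complex.norm_real, Real.norm_of_nonneg (by linarith [χ.le_one (x := ξ)])]
      exact ENNReal.ofReal_le_one.2 (by linarith [χ.nonneg (x := ξ)])
    · rw [χ.one_of_mem_closedBall (by simpa using (not_le.1 h).le)]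
      simp

/-- Cauchy–Schwarz on an annulus of radius comparable to `s`. -/
theorem setLIntegral_annulus_le {g : V → ℝ≥0∞} (hg : Measurable g) {M : ℝ≥0∞} {s : ℝ}
    (hs : 0 < s)
    (h : ∫⁻ ξ in {ξ : V | s ≤ ‖ξ‖ ∧ ‖ξ‖ < 2 * s}, (‖ξ‖ₑ * g ξ) ^ 2 ≤ M ^ 2) :
    ∫⁻ ξ in {ξ : V | s ≤ ‖ξ‖ ∧ ‖ξ‖ < 2 * s}, g ξ ≤
      (ENNReal.ofReal (2 ^ Module.finrank ℝ V) * volume (Metric.ball (0 : V) 1)) ^ (1 / 2 : ℝ) *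
        M * ENNReal.ofReal (s ^ ((Module.finrank ℝ V : ℝ) / 2 - 1)) := by
  set A := {ξ : V | s ≤ ‖ξ‖ ∧ ‖ξ‖ < 2 * s} with hA
  have hAm : MeasurableSet A :=
    (measurableSet_le measurable_const measurable_norm).inter
      (measurableSet_lt measurable_norm measurable_const)
  have hvol : volume A ≤ ENNReal.ofReal ((2 * s) ^ Module.finrank ℝ V) *
      volume (Metric.ball (0 : V) 1) := by
    rw [← Measure.addHaar_ball_of_pos volume (0 : V) (by positivity)]
    exact measure_mono fun ξ hξ => by simpa using hξ.2
  have hsq : ∫⁻ ξ in A, g ξ ^ 2 ≤ ENNReal.ofReal (s⁻¹ ^ 2) * M ^ 2 := by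
    have h1 : ENNReal.ofReal (s ^ 2) * ∫⁻ ξ in A, g ξ ^ 2 ≤ M ^ 2 := by
      refine le_trans ?_ h
      rw [← lintegral_const_mul _ (by fun_prop)]
      refine setLIntegral_mono' hAm fun ξ hξ => ?_
      rw [mul_pow, ENNReal.ofReal_pow hs.le, ← ofReal_norm]
      gcongr
      exact hξ.1
    calc _ = ENNReal.ofReal (s⁻¹ ^ 2) * (ENNReal.ofReal (s ^ 2) * ∫⁻ ξ in A, g ξ ^ 2) := by
          rw [← mul_assoc, ← ENNReal.ofReal_mul (by positivity), ← mul_pow,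
            inv_mul_cancel₀ hs.ne']
          simp
      _ ≤ _ := by gcongr
  have hCS := ENNReal.lintegral_mul_le_Lp_mul_Lq (volume.restrict A)
    Real.HolderConjugate.two_two (f := fun _ => 1) (g := g) (by fun_prop) hg.aemeasurable
  simp only [Pi.mul_apply, one_mul, lintegral_const,
    Measure.restrict_apply_univ, ENNReal.rpow_two, one_pow] at hCS
  refine hCS.trans ?_
  calc _ ≤ (ENNReal.ofReal ((2 * s) ^ Module.finrank ℝ V) *
        volume (Metric.ball (0 : V) 1)) ^ (1 / 2 : ℝ) *
        (ENNReal.ofReal (s⁻¹ ^ 2) * M ^ 2) ^ (1 / 2 : ℝ) := by gcongr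
    _ = (ENNReal.ofReal (2 ^ Module.finrank ℝ V) *
        volume (Metric.ball (0 : V) 1)) ^ (1 / 2 : ℝ) * M *
        (ENNReal.ofReal (s ^ Module.finrank ℝ V) ^ (1 / 2 : ℝ) *
          ENNReal.ofReal (s⁻¹ ^ 2) ^ (1 / 2 : ℝ)) := by
      have hM : (M ^ 2) ^ (1 / 2 : ℝ) = M := by
        rw [← ENNReal.rpow_two, ← ENNReal.rpow_mul]
        norm_num
      simp only [mul_pow, ENNReal.ofReal_mul (pow_nonneg zero_le_two (Module.finrank ℝ V)),
        ENNReal.mul_rpow_of_nonneg _ _ (by norm_num : (0 : ℝ) ≤ 1 / 2), hM]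
      ring
    _ = _ := by
      congr 1
      rw [ENNReal.ofReal_rpow_of_pos (by positivity), ENNReal.ofReal_rpow_of_pos (by positivity),
        ← ENNReal.ofReal_mul (by positivity), ← Real.rpow_natCast, ← Real.rpow_natCast,
        Real.inv_rpow hs.le, ← Real.rpow_neg hs.le, ← Real.rpow_mul hs.le, ← Real.rpow_mul hs.le,
        ← Real.rpow_add hs]
      congr 2
      push_cast
      ring

/-- Uniform weighted `L²` bounds on dyadic annuli control the `L¹` norm on balls. -/
theorem exists_setLIntegral_ball_le (hV : 2 < Module.finrank ℝ V) :
    ∃ C : ℝ, 0 < C ∧ ∀ g : V → ℝ≥0∞, Measurable g → ∀ M : ℝ≥0∞,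
      (∀ k : ℤ, ∫⁻ ξ in {ξ : V | (2 : ℝ) ^ k ≤ ‖ξ‖ ∧ ‖ξ‖ < (2 : ℝ) ^ (k + 1)},
        (‖ξ‖ₑ * g ξ) ^ 2 ≤ M ^ 2) →
      ∀ r : ℝ, 0 < r → ∫⁻ ξ in Metric.ball (0 : V) r, g ξ ≤
        ENNReal.ofReal (C * r ^ ((Module.finrank ℝ V : ℝ) / 2 - 1)) * M := by
  have : Nontrivial V := Module.nontrivial_of_finrank_pos (R := ℝ) (by lia)
  set a : ℝ := (Module.finrank ℝ V : ℝ) / 2 - 1 with ha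
  have ha0 : 0 < a := by
    have : (2 : ℝ) < Module.finrank ℝ V := by exact_mod_cast hV
    linarith
  set B : ℝ≥0∞ := (ENNReal.ofReal (2 ^ Module.finrank ℝ V) *
    volume (Metric.ball (0 : V) 1)) ^ (1 / 2 : ℝ) with hB
  have hBtop : B ≠ ∞ := ENNReal.rpow_ne_top_of_nonneg (by norm_num)
    (ENNReal.mul_ne_top ENNReal.ofReal_ne_top measure_ball_lt_top.ne)
  set q : ℝ≥0∞ := ENNReal.ofReal (2 ^ (-a)) with hq
  have hq1 : q < 1 := by
    rw [hq, ENNReal.ofReal_lt_one]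
    exact Real.rpow_lt_one_of_one_lt_of_neg one_lt_two (by linarith)
  have hqtop : (1 - q)⁻¹ ≠ ∞ := ENNReal.inv_ne_top.2 (tsub_pos_of_lt hq1).ne'
  refine ⟨(B * (1 - q)⁻¹).toReal + 1, by positivity, fun g hg M h r hr => ?_⟩
  obtain ⟨k, hk1, hk2⟩ := exists_mem_Ico_zpow hr one_lt_two
  have hcover : Metric.ball (0 : V) r ⊆ {0} ∪ ⋃ n : ℕ,
      {ξ : V | (2 : ℝ) ^ (k - n) ≤ ‖ξ‖ ∧ ‖ξ‖ < (2 : ℝ) ^ (k - n + 1)} := by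
    intro ξ hξ
    rcases eq_or_ne ξ 0 with rfl | h0
    · simp
    · right
      obtain ⟨j, hj1, hj2⟩ := exists_mem_Ico_zpow (norm_pos_iff.2 h0) one_lt_two
      have hjk : j < k + 1 := by
        refine (zpow_lt_zpow_iff_right₀ (one_lt_two (α := ℝ))).1 (hj1.trans_lt ?_)
        exact (mem_ball_zero_iff.1 hξ).trans hk2
      refine Set.mem_iUnion.2 ⟨(k - j).toNat, ?_⟩
      rw [show k - ((k - j).toNat : ℤ) = j by lia]
      exact ⟨hj1, hj2⟩
  calc ∫⁻ ξ in Metric.ball (0 : V) r, g ξ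
      ≤ ∫⁻ ξ in {0} ∪ ⋃ n : ℕ,
        {ξ : V | (2 : ℝ) ^ (k - n) ≤ ‖ξ‖ ∧ ‖ξ‖ < (2 : ℝ) ^ (k - n + 1)}, g ξ :=
        lintegral_mono_set hcover
    _ ≤ 0 + ∑' n : ℕ, ∫⁻ ξ in
        {ξ : V | (2 : ℝ) ^ (k - n) ≤ ‖ξ‖ ∧ ‖ξ‖ < (2 : ℝ) ^ (k - n + 1)}, g ξ := by
        refine (lintegral_union_le _ _ _).trans ?_
        gcongr
        · rw [setLIntegral_measure_zero _ _ (measure_singleton _)]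
        · exact lintegral_iUnion_le _ _
    _ ≤ ∑' n : ℕ, B * M * (ENNReal.ofReal (r ^ a) * q ^ n) := by
        rw [zero_add]
        refine ENNReal.tsum_le_tsum fun n => ?_
        have h1 := h (k - n)
        have e : (2 : ℝ) ^ (k - n + 1) = 2 * 2 ^ (k - n : ℤ) := by
          rw [zpow_add_one₀ two_ne_zero, mul_comm]
        rw [e] at h1 ⊢
        refine (setLIntegral_annulus_le hg (by positivity) h1).trans ?_
        rw [← hB, ← ha, hq, ← ENNReal.ofReal_pow (by positivity),
          ← ENNReal.ofReal_mul (by positivity)]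
        gcongr
        rw [zpow_sub₀ two_ne_zero, zpow_natCast, Real.div_rpow (by positivity) (by positivity),
          div_eq_mul_inv, Real.rpow_neg zero_le_two, inv_pow, Real.rpow_pow_comm zero_le_two]
        gcongr
    _ = B * (1 - q)⁻¹ * ENNReal.ofReal (r ^ a) * M := by
        rw [ENNReal.tsum_mul_left, ENNReal.tsum_mul_left, ENNReal.tsum_geometric]
        ring
    _ ≤ _ := by
        rw [ENNReal.ofReal_mul (by positivity)]
        gcongr
        rw [← ENNReal.ofReal_toReal (ENNReal.mul_ne_top hBtop hqtop)]
        exact ENNReal.ofReal_le_ofReal (by simp)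

theorem SchwartzMap.lintegral_enorm_mul_fourier_sq_le (f : 𝓢(V, ℂ)) :
    ∫⁻ ξ, (‖ξ‖ₑ * ‖𝓕 f ξ‖ₑ) ^ 2 ≤
      Module.finrank ℝ V * ∫⁻ x, ‖fderiv ℝ f x‖ₑ ^ 2 := by
  let b := stdOrthonormalBasis ℝ V
  calc ∫⁻ ξ, (‖ξ‖ₑ * ‖𝓕 f ξ‖ₑ) ^ 2
      ≤ ∫⁻ ξ, ∑ i, ‖𝓕 (∂_{b i} f) ξ‖ₑ ^ 2 := by
        refine lintegral_mono fun ξ => ?_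
        have e (i) : ‖𝓕 (∂_{b i} f) ξ‖ = 2 * π * ‖inner ℝ ξ (b i)‖ * ‖𝓕 f ξ‖ := by
          have : (inner ℝ · (b i)).HasTemperateGrowth :=
            ((innerSL ℝ).flip (b i)).hasTemperateGrowth
          rw [SchwartzMap.fourier_lineDerivOp_eq]
          simp [this, abs_of_pos pi_pos, mul_assoc]
        simp_rw [← ofReal_norm, e, ← ENNReal.ofReal_mul (norm_nonneg _)]
        rw [← ENNReal.ofReal_pow (by positivity)]
        simp_rw [← ENNReal.ofReal_pow
          (show 0 ≤ 2 * π * ‖inner ℝ ξ (b _)‖ * ‖𝓕 f ξ‖ by positivity)]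
        rw [← ENNReal.ofReal_sum_of_nonneg (fun i _ => by positivity)]
        refine ENNReal.ofReal_le_ofReal ?_
        simp_rw [mul_pow]
        rw [← Finset.sum_mul, ← Finset.mul_sum, b.sum_sq_norm_inner_left]
        have : 1 ≤ 2 ^ 2 * π ^ 2 := by nlinarith [pi_gt_three]
        gcongr
        exact le_mul_of_one_le_left (by positivity) this
    _ = ∑ i, ∫⁻ x, ‖(∂_{b i} f) x‖ₑ ^ 2 := by
        rw [lintegral_finsetSum _ fun i _ => by fun_prop]
        simp_rw [SchwartzMap.lintegral_enorm_sq_fourier]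
    _ ≤ ∑ _i : Fin (Module.finrank ℝ V), ∫⁻ x, ‖fderiv ℝ f x‖ₑ ^ 2 := by
        gcongr with i _ x
        rw [SchwartzMap.lineDerivOp_apply_eq_fderiv, ← ofReal_norm, ← ofReal_norm]
        refine ENNReal.ofReal_le_ofReal ?_
        simpa using (fderiv ℝ f x).le_opNorm (b i)
    _ = _ := by simp

/-- The refined Sobolev inequality in terms of the Fourier transform of `f`. -/
theorem SchwartzMap.exists_lintegral_norm_rpow_le (hV : 2 < Module.finrank ℝ V) :
    ∃ K : ℝ, 0 < K ∧ ∀ f : 𝓢(V, ℂ), ∀ M : ℝ, 0 < M →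
      (∀ k : ℤ, ∫⁻ ξ in {ξ : V | (2 : ℝ) ^ k ≤ ‖ξ‖ ∧ ‖ξ‖ < (2 : ℝ) ^ (k + 1)},
        (‖ξ‖ₑ * ‖𝓕 f ξ‖ₑ) ^ 2 ≤ ENNReal.ofReal M ^ 2) →
      ∫⁻ x, ENNReal.ofReal
          (‖f x‖ ^ (2 * (Module.finrank ℝ V : ℝ) / ((Module.finrank ℝ V : ℝ) - 2))) ≤
        ENNReal.ofReal (K * M ^ (4 / ((Module.finrank ℝ V : ℝ) - 2))) *
          ∫⁻ ξ, (‖ξ‖ₑ * ‖𝓕 f ξ‖ₑ) ^ 2 := by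
  obtain ⟨c, hc, hball⟩ := exists_setLIntegral_ball_le hV
  set d : ℝ := (Module.finrank ℝ V : ℝ) with hd
  have hd2 : 0 < d - 2 := by
    have : (2 : ℝ) < Module.finrank ℝ V := by exact_mod_cast hV
    linarith
  set p : ℝ := 2 * d / (d - 2) with hp
  have hp2 : p - 2 = 4 / (d - 2) := by
    rw [hp]
    field_simp
    ring
  have hp2' : 0 < p - 2 := by
    rw [hp2]
    positivity
  set a : ℝ := d / 2 - 1 with ha
  have ha0 : 0 < a := by linarith
  have hap : a * (p - 2) = 2 := by
    rw [hp2, ha]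
    field_simp
    ring
  refine ⟨p * 4 / (p - 2) * (2 * c) ^ (p - 2) * 4, ?_, fun f M hM h => ?_⟩
  · have : 0 < p := by linarith
    positivity
  have hlayer := lintegral_rpow_le_of_meas_lt_le (μ := volume) (ν := volume)
    (F := fun x : V => ‖f x‖) f.continuous.measurable.norm (fun x => norm_nonneg _)
    (G := fun ξ : V => ‖𝓕 f ξ‖ₑ ^ 2) (by fun_prop)
    (L := fun ξ : V => 2 * c * M * (2 * ‖ξ‖) ^ a) (by fun_prop) (fun ξ => by positivity)
    (p := p) (c := 4) (by linarith) (by norm_num) ?_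
  · refine hlayer.trans (le_of_eq ?_)
    have e (ξ : V) : ENNReal.ofReal ((2 * c * M * (2 * ‖ξ‖) ^ a) ^ (p - 2)) * ‖𝓕 f ξ‖ₑ ^ 2
        = ENNReal.ofReal ((2 * c * M) ^ (p - 2) * 4) * (‖ξ‖ₑ * ‖𝓕 f ξ‖ₑ) ^ 2 := by
      rw [Real.mul_rpow (by positivity) (by positivity), ← Real.rpow_mul (by positivity), hap,
        mul_pow, ← ofReal_norm ξ, ← ENNReal.ofReal_pow (by positivity), ← mul_assoc,
        ← ENNReal.ofReal_mul (by positivity), Real.rpow_two]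
      congr 2
      ring
    simp_rw [e]
    rw [lintegral_const_mul _ (by fun_prop), ← mul_assoc, ← ENNReal.ofReal_mul, ← hp2,
      Real.mul_rpow (by positivity) hM.le]
    · congr 2
      ring
    · have : 0 < p := by linarith
      positivity
  · intro t ht
    set r : ℝ := (t / (2 * c * M)) ^ a⁻¹ with hr
    have hr0 : 0 < r := by positivity
    have hra : r ^ a = t / (2 * c * M) := by
      rw [hr, ← Real.rpow_mul (by positivity), inv_mul_cancel₀ ha0.ne', Real.rpow_one]
    obtain ⟨u, v, hf, hu, hv⟩ := f.exists_add_low_high (half_pos hr0)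
    have hu' (x) : ‖u x‖ ≤ t / 2 := by
      have h1 := (hu x).trans (hball _ (by fun_prop) _ h _ (by positivity))
      rw [mul_div_cancel₀ r two_ne_zero, hra, ← ENNReal.ofReal_mul (by positivity),
        ← ofReal_norm, ENNReal.ofReal_le_ofReal_iff (by positivity)] at h1
      refine h1.trans (le_of_eq ?_)
      field_simp
    have hsub : {x | t < ‖f x‖} ⊆ {x | ENNReal.ofReal (t / 2) ^ 2 ≤ ‖v x‖ₑ ^ 2} := by
      intro x hx
      have h1 : ‖f x‖ ≤ ‖u x‖ + ‖v x‖ := by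
        rw [hf]
        exact norm_add_le _ _
      have hx' : t < ‖f x‖ := hx
      have h2 : t / 2 ≤ ‖v x‖ := by linarith [hu' x]
      simp only [Set.mem_ofPred_eq, ← ofReal_norm]
      gcongr
    refine (measure_mono hsub).trans ((meas_ge_le_lintegral_div (by fun_prop) ?_ ?_).trans ?_)
    · simp [ht]
    · simp
    · rw [ENNReal.div_eq_inv_mul]
      gcongr ?_ * ?_
      · rw [← ENNReal.ofReal_pow (by positivity), ← ENNReal.ofReal_inv_of_pos (by positivity)]
        refine ENNReal.ofReal_le_ofReal (le_of_eq ?_)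
        rw [Real.rpow_neg ht.le, Real.rpow_two]
        field_simp
        norm_num
      · refine hv.trans (lintegral_mono_set fun ξ hξ => ?_)
        have hξ' : r ≤ 2 * ‖ξ‖ := by
          have : r / 2 ≤ ‖ξ‖ := hξ
          linarith
        have := Real.rpow_le_rpow hr0.le hξ' ha0.le
        rw [hra, div_le_iff₀ (by positivity)] at this
        simp only [Set.mem_ofPred_eq]
        linarith

theorem SchwartzMap.norm_fourier_fderiv_apply (f : 𝓢(V, ℂ)) (ξ : V) :
    ‖𝓕 (fun x => fderiv ℝ f x) ξ‖ = 2 * π * ‖ξ‖ * ‖𝓕 f ξ‖ := by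
  rw [Real.fourier_fderiv f.integrable f.differentiable (SchwartzMap.fderivCLM ℝ V ℂ f).integrable,
    VectorFourier.norm_fourierSMulRight, SchwartzMap.fourier_coe, neg_apply, norm_neg,
    innerSL_apply_norm]

theorem SchwartzMap.integrable_norm_sq_fderiv (f : 𝓢(V, ℂ)) :
    Integrable fun x => ‖fderiv ℝ f x‖ ^ 2 :=
  ((SchwartzMap.fderivCLM ℝ V ℂ f).memLp 2 volume).integrable_norm_pow two_ne_zero

theorem SchwartzMap.integrable_norm_sq_fourier_fderiv (f : 𝓢(V, ℂ)) :
    Integrable fun ξ => ‖𝓕 (fun x => fderiv ℝ f x) ξ‖ ^ 2 :=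
  ((𝓕 (SchwartzMap.fderivCLM ℝ V ℂ f)).memLp 2 volume).integrable_norm_pow two_ne_zero

end Fourier

/-- refined Sobolev inequality
`‖f‖_{L^{2N/(N-2)}} ≤ C ‖∇f‖_{L²}^{1-2/N} ‖∇f‖_{Ḃ⁰_{2,∞}}^{2/N}`, where the Besov
seminorm is the supremum over `k ∈ ℤ` of the `L²` norms of the Littlewood–Paley
pieces of `∇f` (frequencies `2^k ≤ |ξ| < 2^{k+1}`, via the Fourier transform). -/
theorem refined_sobolev (N : ℕ) (hN : 3 ≤ N) :
    ∃ C : ℝ, 0 < C ∧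
      ∀ f : SchwartzMap (EuclideanSpace ℝ (Fin N)) ℂ,
        (∫ x : EuclideanSpace ℝ (Fin N), ‖f x‖ ^ (2 * (N : ℝ) / ((N : ℝ) - 2)))
            ^ (((N : ℝ) - 2) / (2 * (N : ℝ)))
          ≤ C * ((∫ x : EuclideanSpace ℝ (Fin N), ‖fderiv ℝ (⇑f) x‖ ^ 2)
                  ^ ((1 : ℝ) / 2)) ^ (1 - 2 / (N : ℝ))
              * (⨆ k : ℤ,
                  (∫ ξ in {ξ : EuclideanSpace ℝ (Fin N) |
                      (2 : ℝ) ^ k ≤ ‖ξ‖ ∧ ‖ξ‖ < (2 : ℝ) ^ (k + 1)},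
                    ‖𝓕 (fun x => fderiv ℝ (⇑f) x) ξ‖ ^ 2) ^ ((1 : ℝ) / 2))
                ^ (2 / (N : ℝ)) := by
  obtain ⟨K, hK, hmain⟩ := SchwartzMap.exists_lintegral_norm_rpow_le
    (V := EuclideanSpace ℝ (Fin N)) (by simpa using Nat.lt_of_succ_le hN)
  simp only [finrank_euclideanSpace_fin] at hmain
  have hN3 : (3 : ℝ) ≤ N := by exact_mod_cast hN
  have hN2 : 0 < (N : ℝ) - 2 := by linarith
  refine ⟨(K * N) ^ (((N : ℝ) - 2) / (2 * N)), by positivity, fun f => ?_⟩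
  set b : ℤ → ℝ := fun k => (∫ ξ in {ξ : EuclideanSpace ℝ (Fin N) |
    (2 : ℝ) ^ k ≤ ‖ξ‖ ∧ ‖ξ‖ < (2 : ℝ) ^ (k + 1)},
      ‖𝓕 (fun x => fderiv ℝ (⇑f) x) ξ‖ ^ 2) ^ ((1 : ℝ) / 2) with hb
  set D : ℝ := ∫ x : EuclideanSpace ℝ (Fin N), ‖fderiv ℝ (⇑f) x‖ ^ 2 with hD
  have hD0 : 0 ≤ D := integral_nonneg fun x => by positivity
  have hF := f.integrable_norm_sq_fourier_fderiv
  have hbdd : BddAbove (Set.range b) := by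
    refine ⟨(∫ ξ, ‖𝓕 (fun x => fderiv ℝ (⇑f) x) ξ‖ ^ 2) ^ ((1 : ℝ) / 2), ?_⟩
    rintro _ ⟨k, rfl⟩
    refine Real.rpow_le_rpow (integral_nonneg fun x => by positivity) ?_ (by norm_num)
    exact setIntegral_le_integral hF (Filter.Eventually.of_forall fun x => by positivity)
  have hb0 (k) : 0 ≤ b k := Real.rpow_nonneg (integral_nonneg fun x => by positivity) _
  have hS0 : 0 ≤ ⨆ k, b k := Real.iSup_nonneg hb0
  have key : ∀ M, (⨆ k, b k) < M →
      (∫ x : EuclideanSpace ℝ (Fin N), ‖f x‖ ^ (2 * (N : ℝ) / ((N : ℝ) - 2)))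
          ^ (((N : ℝ) - 2) / (2 * (N : ℝ)))
        ≤ (K * N) ^ (((N : ℝ) - 2) / (2 * N)) * (D ^ ((1 : ℝ) / 2)) ^ (1 - 2 / (N : ℝ))
          * M ^ (2 / (N : ℝ)) := by
    intro M hM
    have hM0 : 0 < M := hS0.trans_lt hM
    have hshell (k : ℤ) : ∫⁻ ξ in {ξ : EuclideanSpace ℝ (Fin N) |
        (2 : ℝ) ^ k ≤ ‖ξ‖ ∧ ‖ξ‖ < (2 : ℝ) ^ (k + 1)}, (‖ξ‖ₑ * ‖𝓕 f ξ‖ₑ) ^ 2 ≤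
        ENNReal.ofReal M ^ 2 := by
      calc _ ≤ ∫⁻ ξ in {ξ : EuclideanSpace ℝ (Fin N) |
            (2 : ℝ) ^ k ≤ ‖ξ‖ ∧ ‖ξ‖ < (2 : ℝ) ^ (k + 1)},
            ENNReal.ofReal (‖𝓕 (fun x => fderiv ℝ (⇑f) x) ξ‖ ^ 2) := by
            gcongr with ξ
            rw [f.norm_fourier_fderiv_apply, ← ofReal_norm, ← ofReal_norm,
              ← ENNReal.ofReal_mul (norm_nonneg _), ← ENNReal.ofReal_pow (by positivity)]
            gcongr
            exact le_mul_of_one_le_left (by positivity) (by linarith [pi_gt_three])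
        _ = ENNReal.ofReal (b k ^ 2) := by
            rw [← ofReal_integral_eq_lintegral_ofReal hF.integrableOn
              (Filter.Eventually.of_forall fun x => by positivity), hb, ← Real.rpow_two,
              ← Real.rpow_mul (integral_nonneg fun x => by positivity)]
            norm_num
        _ ≤ _ := by
            rw [← ENNReal.ofReal_pow hM0.le]
            have := hb0 k
            gcongr
            exact (le_ciSup hbdd k).trans hM.le
    have hgrad := f.lintegral_enorm_mul_fourier_sq_le
    have hDl : ∫⁻ x, ‖fderiv ℝ f x‖ₑ ^ 2 = ENNReal.ofReal D := by
      rw [hD, ofReal_integral_eq_lintegral_ofReal f.integrable_norm_sq_fderiv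
        (Filter.Eventually.of_forall fun x => by positivity)]
      simp_rw [ENNReal.ofReal_pow (norm_nonneg _), ofReal_norm]
    rw [hDl, finrank_euclideanSpace_fin] at hgrad
    have hI : ∫ x : EuclideanSpace ℝ (Fin N), ‖f x‖ ^ (2 * (N : ℝ) / ((N : ℝ) - 2)) ≤
        K * N * (M ^ (4 / ((N : ℝ) - 2)) * D) := by
      rw [integral_eq_lintegral_of_nonneg_ae
        (Filter.Eventually.of_forall fun x => by positivity)
        (f.continuous.measurable.norm.pow_const _).aestronglyMeasurable]
      refine ENNReal.toReal_le_of_le_ofReal (by positivity) ((hmain f M hM0 hshell).trans ?_)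
      grw [hgrad]
      rw [← ENNReal.ofReal_natCast, ← ENNReal.ofReal_mul (by positivity),
        ← ENNReal.ofReal_mul (by positivity)]
      exact ENNReal.ofReal_le_ofReal (le_of_eq (by ring))
    refine (Real.rpow_le_rpow (integral_nonneg fun x => by positivity) hI
      (by positivity)).trans (le_of_eq ?_)
    rw [Real.mul_rpow (by positivity) (by positivity), Real.mul_rpow (by positivity) hD0,
      ← Real.rpow_mul hM0.le, ← Real.rpow_mul hD0, mul_assoc, mul_comm (M ^ _)]
    congr 3
    · field_simp
    · field_simp
      norm_num
  refine ge_of_tendsto (x := nhdsWithin (⨆ k, b k) (Set.Ioi (⨆ k, b k))) ?_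
    (Filter.Eventually.mono self_mem_nhdsWithin key)
  refine Filter.Tendsto.mono_left ?_ nhdsWithin_le_nhds
  exact (Real.continuousAt_rpow_const _ _ (Or.inr (by positivity))).tendsto.const_mul _
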